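/- Let m ≥ 1 and let H : ℝ^{2m} → ℝ be continuously differentiable with e^{-H} Lebesgue integrable. A Borel probability measure μ on ℝ^{2m} satisfies the classical KMS condition ∫ {f,g} dμ = ∫ g {f,H} dμ for all smooth compactly supported f, g : ℝ^{2m} → ℝ if and only if μ is the Gibbs measure dμ = Z^{-1} e^{-H} dx, where Z := ∫_{ℝ^{2m}} e^{-H(x)} dx. In particular, the classical KMS state for H is unique and coincides with the Gibbs state. -/

import Mathlib

open MeasureTheory
/-- The standard Poisson bracket on `ℝ^{2m}`:
`{f,g} := Σ_{i=1}^m (∂f/∂x_i · ∂g/∂x_{m+i} − ∂f/∂x_{m+i} · ∂g/∂x_i)`. -/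
noncomputable def poissonBracket (m : ℕ) (f g : (Fin (2 * m) → ℝ) → ℝ)
    (x : Fin (2 * m) → ℝ) : ℝ :=
  ∑ i : Fin m,
    (fderiv ℝ f x (Pi.single (⟨i.1, by have := i.isLt; omega⟩ : Fin (2 * m)) 1) *
        fderiv ℝ g x (Pi.single (⟨m + i.1, by have := i.isLt; omega⟩ : Fin (2 * m)) 1) -
      fderiv ℝ f x (Pi.single (⟨m + i.1, by have := i.isLt; omega⟩ : Fin (2 * m)) 1) *
        fderiv ℝ g x (Pi.single (⟨i.1, by have := i.isLt; omega⟩ : Fin (2 * m)) 1))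

open Metric in
/-- A compactly supported `C¹` function is approximated in `C¹` norm by smooth functions supported
in the unit thickening of its support. -/
theorem exists_contDiff_fderiv_approx {E : Type*} [NormedAddCommGroup E] [NormedSpace ℝ E]
    [FiniteDimensional ℝ E] {φ : E → ℝ} (hφ : ContDiff ℝ 1 φ) (hc : HasCompactSupport φ)
    {ε : ℝ} (hε : 0 < ε) :
    ∃ g : E → ℝ, ContDiff ℝ (⊤ : ℕ∞) g ∧ (∀ x ∉ cthickening 1 (tsupport φ), g x = 0) ∧
      (∀ x, ‖g x - φ x‖ ≤ ε) ∧ ∀ x, ‖fderiv ℝ g x - fderiv ℝ φ x‖ ≤ ε := by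
  borelize E
  let μ : Measure E := .addHaar
  obtain ⟨δ₁, hδ₁, h₁⟩ := Metric.uniformContinuous_iff.mp
    (hc.uniformContinuous_of_continuous hφ.continuous) ε hε
  have hd : Continuous (fderiv ℝ φ) := hφ.continuous_fderiv one_ne_zero
  obtain ⟨δ₂, hδ₂, h₂⟩ := Metric.uniformContinuous_iff.mp
    ((hc.fderiv (𝕜 := ℝ)).uniformContinuous_of_continuous hd) ε hε
  let r := min 1 (min δ₁ δ₂)
  have hr : 0 < r := lt_min one_pos (lt_min hδ₁ hδ₂)
  let ρ : ContDiffBump (0 : E) := ⟨r / 2, r, half_pos hr, half_lt_self hr⟩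
  refine ⟨convolution (ρ.normed μ) φ (ContinuousLinearMap.lsmul ℝ ℝ) μ,
    ρ.hasCompactSupport_normed.contDiff_convolution_left _ ρ.contDiff_normed
      hφ.continuous.locallyIntegrable, fun x hx ↦ ?_, fun x ↦ ?_, fun x ↦ ?_⟩
  · have h0 : ∀ y ∈ closedBall x 1, φ y = 0 := fun y hy ↦ image_eq_zero_of_notMem_tsupport
      fun hy' ↦ hx (mem_cthickening_of_dist_le x y _ _ hy' (by rwa [dist_comm]))
    have hx0 : φ x = 0 := h0 x (mem_closedBall_self zero_le_one)
    have := ρ.dist_normed_convolution_le (μ := μ) (g := φ) (x₀ := x) (ε := 0)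
      hφ.continuous.aestronglyMeasurable fun y hy ↦ by
        rw [h0 y (ball_subset_closedBall (ball_subset_ball (min_le_left _ _) hy)), hx0, dist_self]
    rwa [hx0, dist_le_zero] at this
  · rw [← dist_eq_norm]
    exact ρ.dist_normed_convolution_le hφ.continuous.aestronglyMeasurable fun y hy ↦
      (h₁ (lt_of_lt_of_le hy ((min_le_right _ _).trans (min_le_left _ _)))).le
  · rw [(hc.hasFDerivAt_convolution_right (ContinuousLinearMap.lsmul ℝ ℝ)
      ρ.continuous_normed.locallyIntegrable hφ x).fderiv, ← dist_eq_norm]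
    exact ρ.dist_normed_convolution_le hd.aestronglyMeasurable fun y hy ↦
      (h₂ (lt_of_lt_of_le hy ((min_le_right _ _).trans (min_le_right _ _)))).le

theorem norm_integral_le_mul_of_forall_notMem {X : Type*} [MeasurableSpace X] {μ : Measure X}
    {K : Set X} (hK : μ K < ⊤) {f : X → ℝ} {C : ℝ} (hf : ∀ x ∉ K, f x = 0)
    (hC : ∀ x ∈ K, ‖f x‖ ≤ C) : ‖∫ x, f x ∂μ‖ ≤ C * μ.real K := by
  rw [← setIntegral_eq_integral_of_forall_compl_eq_zero hf]
  exact norm_setIntegral_le_of_norm_le_const hK hC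

open Metric in
/-- Measures finite on compact sets are determined by their integrals of smooth compactly
supported functions. -/
theorem ext_of_integral_contDiff {E : Type*} [NormedAddCommGroup E] [NormedSpace ℝ E]
    [FiniteDimensional ℝ E] [MeasurableSpace E] [BorelSpace E] {μ ν : Measure E}
    [IsFiniteMeasureOnCompacts μ] [IsFiniteMeasureOnCompacts ν]
    (h : ∀ g : E → ℝ, ContDiff ℝ (⊤ : ℕ∞) g → HasCompactSupport g →
      ∫ x, g x ∂μ = ∫ x, g x ∂ν) : μ = ν := by
  have := FiniteDimensional.proper ℝ E
  refine Measure.ext_of_integral_eq_on_compactlySupported fun ψ ↦ ?_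
  have hK : IsCompact (cthickening 1 (tsupport ψ)) := ψ.hasCompactSupport.isCompact.cthickening
  set K := cthickening 1 (tsupport ψ)
  have hψ : Continuous (ψ : E → ℝ) := ψ.continuous
  have hψK : ∀ x ∉ K, ψ x = 0 := fun x hx ↦ image_eq_zero_of_notMem_tsupport
    fun hx' ↦ hx (self_subset_cthickening _ hx')
  have key : ∀ ε > 0, ‖∫ x, ψ x ∂μ - ∫ x, ψ x ∂ν‖ ≤ ε * (μ.real K + ν.real K) := by
    intro ε hε
    obtain ⟨δ, hδ, hu⟩ := Metric.uniformContinuous_iff.mp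
      (ψ.hasCompactSupport.uniformContinuous_of_continuous hψ) ε hε
    obtain ⟨g, hg, hgd⟩ := hψ.exists_contDiff_dist_le_of_forall_mem_ball_dist_le
      (lt_min one_pos hδ)
    have hgψ : ∀ x, ‖ψ x - g x‖ ≤ ε := fun x ↦ by
      rw [← dist_eq_norm, dist_comm]
      exact hgd x ε fun y hy ↦ (hu (lt_of_lt_of_le hy (min_le_right _ _))).le
    have hgK : ∀ x ∉ K, g x = 0 := fun x hx ↦ by
      have := hgd x 0 fun y hy ↦ by
        rw [hψK x hx, image_eq_zero_of_notMem_tsupport (f := ψ) (x := y), dist_self]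
        refine fun hy' ↦ hx (mem_cthickening_of_dist_le x y _ _ hy' ?_)
        rw [dist_comm]
        exact (lt_of_lt_of_le hy (min_le_left _ _)).le
      rwa [hψK x hx, dist_le_zero] at this
    have hgc : HasCompactSupport g := .intro hK hgK
    have bound : ∀ η : Measure E, [IsFiniteMeasureOnCompacts η] →
        ‖∫ x, ψ x ∂η - ∫ x, g x ∂η‖ ≤ ε * η.real K := fun η _ ↦ by
      rw [← integral_sub (hψ.integrable_of_hasCompactSupport ψ.hasCompactSupport)
        (hg.continuous.integrable_of_hasCompactSupport hgc)]
      exact norm_integral_le_mul_of_forall_notMem hK.measure_lt_top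
        (fun x hx ↦ by rw [hψK x hx, hgK x hx, sub_zero]) fun x _ ↦ hgψ x
    have h1 := bound μ
    have h2 := bound ν
    rw [h g hg hgc] at h1
    rw [norm_sub_rev] at h2
    calc _ ≤ _ := norm_sub_le_norm_sub_add_norm_sub _ (∫ x, g x ∂ν) _
      _ ≤ _ := by rw [mul_add]; exact add_le_add h1 h2
  refine sub_eq_zero.mp (norm_le_zero_iff.mp (le_of_forall_pos_le_add fun ε hε ↦ ?_))
  have hpos : 0 < μ.real K + ν.real K + 1 := by positivity
  refine (key _ (div_pos hε hpos)).trans ?_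
  rw [zero_add, div_mul_eq_mul_div, div_le_iff₀ hpos]
  nlinarith

/-- A measure annihilating the derivatives of `C¹` compactly supported functions in direction `v`
is invariant under translation by `v`. -/
theorem map_add_left_eq_self_of_integral_fderiv_eq_zero {E : Type*} [NormedAddCommGroup E]
    [NormedSpace ℝ E] [FiniteDimensional ℝ E] [MeasurableSpace E] [BorelSpace E] {ν : Measure E}
    [IsFiniteMeasureOnCompacts ν] {v : E}
    (h : ∀ ψ : E → ℝ, ContDiff ℝ 1 ψ → HasCompactSupport ψ → ∫ x, fderiv ℝ ψ x v ∂ν = 0) :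
    ν.map (v + ·) = ν := by
  have := FiniteDimensional.proper ℝ E
  have : IsFiniteMeasureOnCompacts (ν.map (v + ·)) :=
    Measure.IsFiniteMeasureOnCompacts.map ν (Homeomorph.addLeft v)
  refine ext_of_integral_contDiff fun g hg hgc ↦ ?_
  rw [(measurableEmbedding_addLeft v).integral_map]
  have hg1 : ContDiff ℝ 1 g := hg.of_le (by exact_mod_cast le_top)
  have hgd : Continuous (fderiv ℝ g) := hg1.continuous_fderiv one_ne_zero
  have hderiv : ∀ t₀ : ℝ, HasDerivAt (fun t : ℝ ↦ ∫ x, g (t • v + x) ∂ν) 0 t₀ := by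
    intro t₀
    have hcomp : ∀ t : ℝ, HasCompactSupport fun x ↦ g (t • v + x) := fun t ↦
      hgc.comp_homeomorph (Homeomorph.addLeft (t • v))
    have hsm : ∀ t : ℝ, ContDiff ℝ 1 fun x ↦ g (t • v + x) := fun t ↦
      hg1.comp (contDiff_const.add contDiff_id)
    obtain ⟨M, hM⟩ := (hgc.fderiv (𝕜 := ℝ)).exists_bound_of_continuous hgd
    let K := (fun p : ℝ × E ↦ p.2 - p.1 • v) '' (Metric.closedBall t₀ 1 ×ˢ tsupport g)
    have hK : IsCompact K := ((isCompact_closedBall t₀ 1).prod hgc.isCompact).image (by fun_prop)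
    have hzero : ∫ x, fderiv ℝ g (t₀ • v + x) v ∂ν = 0 := by
      rw [← h _ (hsm t₀) (hcomp t₀)]
      simp_rw [fderiv_comp_add_left]
    rw [← hzero]
    refine (hasDerivAt_integral_of_dominated_loc_of_deriv_le
      (F := fun (t : ℝ) x ↦ g (t • v + x)) (F' := fun t x ↦ fderiv ℝ g (t • v + x) v)
      (bound := K.indicator fun _ ↦ M * ‖v‖) (Metric.closedBall_mem_nhds t₀ one_pos)
      (.of_forall fun t ↦ (hsm t).continuous.aestronglyMeasurable)
      ((hsm t₀).continuous.integrable_of_hasCompactSupport (hcomp t₀))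
      (Continuous.aestronglyMeasurable (by fun_prop)) (.of_forall fun x t ht ↦ ?_)
      ((integrable_indicator_iff hK.measurableSet).mpr
        (integrableOn_const hK.measure_lt_top.ne)) (.of_forall fun x t _ ↦ ?_)).2
    · by_cases hx : t • v + x ∈ tsupport g
      · rw [Set.indicator_of_mem (show x ∈ K from ⟨(t, t • v + x), ⟨ht, hx⟩, by simp⟩)]
        exact ((fderiv ℝ g _).le_opNorm v).trans
          (mul_le_mul_of_nonneg_right (hM _) (norm_nonneg v))
      · rw [fderiv_of_notMem_tsupport ℝ hx]
        simp only [zero_apply, norm_zero]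
        exact Set.indicator_nonneg (fun _ _ ↦ mul_nonneg
          ((norm_nonneg _).trans (hM 0)) (norm_nonneg v)) x
    · have h1 : HasDerivAt (fun s : ℝ ↦ s • v + x) v t := by
        simpa using ((hasDerivAt_id t).smul_const v).add_const x
      exact ((hg1.differentiable one_ne_zero _).hasFDerivAt).comp_hasDerivAt t h1
  simpa using is_const_of_deriv_eq_zero (fun t ↦ (hderiv t).differentiableAt)
    (fun t ↦ (hderiv t).deriv) 1 0

/-- A functional identity `∫ ∂ᵥφ = ∫ φ a` for smooth test functions extends to `C¹` ones. -/
theorem integral_fderiv_eq_of_forall_contDiff {E : Type*} [NormedAddCommGroup E]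
    [NormedSpace ℝ E] [FiniteDimensional ℝ E] [MeasurableSpace E] [BorelSpace E] {μ : Measure E}
    [IsFiniteMeasureOnCompacts μ] {a : E → ℝ} (ha : Continuous a) {v : E}
    (h : ∀ φ : E → ℝ, ContDiff ℝ (⊤ : ℕ∞) φ → HasCompactSupport φ →
      ∫ x, fderiv ℝ φ x v ∂μ = ∫ x, φ x * a x ∂μ)
    {φ : E → ℝ} (hφ : ContDiff ℝ 1 φ) (hc : HasCompactSupport φ) :
    ∫ x, fderiv ℝ φ x v ∂μ = ∫ x, φ x * a x ∂μ := by
  have := FiniteDimensional.proper ℝ E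
  have hK : IsCompact (Metric.cthickening 1 (tsupport φ)) := hc.isCompact.cthickening
  set K := Metric.cthickening 1 (tsupport φ)
  have hint₁ : ∀ {g : E → ℝ}, ContDiff ℝ 1 g → HasCompactSupport g →
      Integrable (fun x ↦ fderiv ℝ g x v) μ := fun {g} hg hgc ↦
    ((hg.continuous_fderiv one_ne_zero).clm_apply
      continuous_const).integrable_of_hasCompactSupport (hgc.fderiv_apply (𝕜 := ℝ) v)
  have hint₂ : ∀ {g : E → ℝ}, ContDiff ℝ 1 g → HasCompactSupport g →
      Integrable (fun x ↦ g x * a x) μ := fun {g} hg hgc ↦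
    (hg.continuous.mul ha).integrable_of_hasCompactSupport hgc.mul_right
  have hint₃ : ∀ {g : E → ℝ}, ContDiff ℝ 1 g → HasCompactSupport g →
      Integrable (fun x ↦ g x * a x - fderiv ℝ g x v) μ := fun hg hgc ↦
    (hint₂ hg hgc).sub (hint₁ hg hgc)
  obtain ⟨A, hA⟩ := hK.exists_bound_of_continuousOn ha.continuousOn
  have hsub : tsupport φ ⊆ K := Metric.self_subset_cthickening _
  set B := (‖v‖ + |A|) * μ.real K
  have hB : 0 ≤ B := by positivity
  have key : ∀ ε > 0, ‖∫ x, fderiv ℝ φ x v ∂μ - ∫ x, φ x * a x ∂μ‖ ≤ ε * B := by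
    intro ε hε
    obtain ⟨g, hg, hgK, hg0, hg1⟩ := exists_contDiff_fderiv_approx hφ hc hε
    have hgc : HasCompactSupport g := .intro hK hgK
    have hg' : ContDiff ℝ 1 g := hg.of_le (by exact_mod_cast le_top)
    have hgs : tsupport g ⊆ K := closure_minimal
      (fun x hx ↦ by_contra fun hx' ↦ hx (hgK x hx')) Metric.isClosed_cthickening
    have heq : ∫ x, fderiv ℝ φ x v ∂μ - ∫ x, φ x * a x ∂μ =
        ∫ x, ((φ x * a x - fderiv ℝ φ x v) - (g x * a x - fderiv ℝ g x v)) * (-1) ∂μ := by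
      rw [integral_mul_const, integral_sub (hint₃ hφ hc) (hint₃ hg' hgc),
        integral_sub (hint₂ hφ hc) (hint₁ hφ hc),
        integral_sub (hint₂ hg' hgc) (hint₁ hg' hgc), h g hg hgc]
      ring
    rw [heq, ← mul_assoc]
    refine norm_integral_le_mul_of_forall_notMem hK.measure_lt_top (fun x hx ↦ ?_)
      fun x hx ↦ ?_
    · rw [fderiv_of_notMem_tsupport ℝ fun h' ↦ hx (hsub h'),
        fderiv_of_notMem_tsupport ℝ fun h' ↦ hx (hgs h'),
        image_eq_zero_of_notMem_tsupport fun h' ↦ hx (hsub h'), hgK x hx]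
      simp
    · have e : ((φ x * a x - fderiv ℝ φ x v) - (g x * a x - fderiv ℝ g x v)) * (-1) =
          (g x - φ x) * a x - (fderiv ℝ g x - fderiv ℝ φ x) v := by
        rw [sub_apply]; ring
      rw [e]
      have h1 : ‖(g x - φ x) * a x‖ ≤ ε * |A| := by
        rw [norm_mul]
        exact mul_le_mul (hg0 x) ((hA x hx).trans (le_abs_self A)) (norm_nonneg _) hε.le
      have h2 : ‖(fderiv ℝ g x - fderiv ℝ φ x) v‖ ≤ ε * ‖v‖ :=
        ((fderiv ℝ g x - fderiv ℝ φ x).le_opNorm v).trans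
          (mul_le_mul_of_nonneg_right (hg1 x) (norm_nonneg v))
      linarith [norm_sub_le ((g x - φ x) * a x) ((fderiv ℝ g x - fderiv ℝ φ x) v)]
  refine sub_eq_zero.mp (norm_le_zero_iff.mp (le_of_forall_pos_le_add fun ε hε ↦ ?_))
  refine (key _ (div_pos hε (add_pos_of_nonneg_of_pos hB one_pos))).trans ?_
  rw [zero_add, div_mul_eq_mul_div, div_le_iff₀ (by positivity)]
  nlinarith

/-- Integration by parts twice: `∫ ∂ᵥf ∂ᵤh = ∫ ∂ᵤf ∂ᵥh`. -/
theorem integral_fderiv_mul_fderiv_comm {E : Type*} [NormedAddCommGroup E]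
    [NormedSpace ℝ E] [FiniteDimensional ℝ E] [MeasurableSpace E] [BorelSpace E] {μ : Measure E}
    [μ.IsAddHaarMeasure] {f h : E → ℝ} (hf : ContDiff ℝ 2 f) (hh : ContDiff ℝ 1 h)
    (hc : HasCompactSupport h) (v w : E) :
    ∫ x, fderiv ℝ f x v * fderiv ℝ h x w ∂μ = ∫ x, fderiv ℝ f x w * fderiv ℝ h x v ∂μ := by
  have hfd : ContDiff ℝ 1 (fderiv ℝ f) := hf.fderiv_right (by norm_num)
  have hfv : ∀ u, ContDiff ℝ 1 fun x ↦ fderiv ℝ f x u := fun u ↦ hfd.clm_apply contDiff_const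
  have hhv : ∀ u, Continuous fun x ↦ fderiv ℝ h x u := fun u ↦
    (hh.continuous_fderiv one_ne_zero).clm_apply continuous_const
  have hfvw : ∀ u w, Continuous fun x ↦ fderiv ℝ (fun x ↦ fderiv ℝ f x u) x w := fun u w ↦
    ((hfv u).continuous_fderiv one_ne_zero).clm_apply continuous_const
  have parts : ∀ u w, ∫ x, fderiv ℝ f x u * fderiv ℝ h x w ∂μ =
      - ∫ x, fderiv ℝ (fderiv ℝ f) x w u * h x ∂μ := by
    intro u w
    rw [integral_mul_fderiv_eq_neg_fderiv_mul_of_integrable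
      (f := fun x ↦ fderiv ℝ f x u) (g := h)
      (((hfvw u w).mul hh.continuous).integrable_of_hasCompactSupport hc.mul_left)
      (((hfv u).continuous.mul (hhv w)).integrable_of_hasCompactSupport
        (hc.fderiv_apply (𝕜 := ℝ) w).mul_left)
      (((hfv u).continuous.mul hh.continuous).integrable_of_hasCompactSupport hc.mul_left)
      (fun x _ ↦ (hfv u).differentiable one_ne_zero x)
      fun x _ ↦ hh.differentiable one_ne_zero x]
    congr 2 with x
    rw [fderiv_clm_apply (hfd.differentiable one_ne_zero x) (differentiableAt_const u)]
    simp
  rw [parts, parts]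
  congr 2 with x
  rw [(hf.contDiffAt.isSymmSndFDerivAt (by simp)).eq]

/-- A linear functional agrees to first order near a compact set with a test function. -/
theorem exists_contDiff_fderiv_eq {E : Type*} [NormedAddCommGroup E]
    [NormedSpace ℝ E] [FiniteDimensional ℝ E] (ℓ : E →L[ℝ] ℝ) {K : Set E} (hK : IsCompact K) :
    ∃ f : E → ℝ, ContDiff ℝ (⊤ : ℕ∞) f ∧ HasCompactSupport f ∧ ∀ x ∈ K, fderiv ℝ f x = ℓ := by
  obtain ⟨R, hR, hKR⟩ := hK.isBounded.subset_ball_lt 0 (0 : E)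
  let χ : ContDiffBump (0 : E) := ⟨R, R + 1, hR, lt_add_one R⟩
  refine ⟨fun x ↦ χ x * ℓ x, χ.contDiff.mul ℓ.contDiff, χ.hasCompactSupport.mul_right,
    fun x hx ↦ ?_⟩
  have : (fun x ↦ χ x * ℓ x) =ᶠ[nhds x] ℓ := by
    filter_upwards [χ.eventuallyEq_one_of_mem_ball (hKR hx)] with y hy
    rw [hy, Pi.one_apply, one_mul]
  rw [this.fderiv_eq, ℓ.fderiv]

theorem continuous_poissonBracket {m : ℕ} {f g : (Fin (2 * m) → ℝ) → ℝ} (hf : ContDiff ℝ 1 f)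
    (hg : ContDiff ℝ 1 g) : Continuous (poissonBracket m f g) := by
  have hf' := hf.continuous_fderiv one_ne_zero
  have hg' := hg.continuous_fderiv one_ne_zero
  unfold poissonBracket
  fun_prop

theorem poissonBracket_of_notMem_tsupport {m : ℕ} {f g : (Fin (2 * m) → ℝ) → ℝ}
    {x : Fin (2 * m) → ℝ} (hx : x ∉ tsupport g) : poissonBracket m f g x = 0 := by
  simp [poissonBracket, fderiv_of_notMem_tsupport ℝ hx]

theorem poissonBracket_mul_exp_neg {m : ℕ} {f g H : (Fin (2 * m) → ℝ) → ℝ}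
    {x : Fin (2 * m) → ℝ} (hg : DifferentiableAt ℝ g x) (hH : DifferentiableAt ℝ H x) :
    poissonBracket m f (fun y ↦ g y * Real.exp (-H y)) x =
      Real.exp (-H x) * poissonBracket m f g x -
        Real.exp (-H x) * (g x * poissonBracket m f H x) := by
  have hd : ∀ v, fderiv ℝ (fun y ↦ g y * Real.exp (-H y)) x v =
      Real.exp (-H x) * fderiv ℝ g x v - Real.exp (-H x) * (g x * fderiv ℝ H x v) := by
    intro v
    rw [HasFDerivAt.fderiv (f := fun y ↦ g y * Real.exp (-H y))
      (hg.hasFDerivAt.mul hH.hasFDerivAt.neg.exp)]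
    simp
    ring
  simp only [poissonBracket, hd, Finset.mul_sum, ← Finset.sum_sub_distrib]
  exact Finset.sum_congr rfl fun i _ ↦ by ring

theorem integral_poissonBracket_eq_zero {m : ℕ} {f h : (Fin (2 * m) → ℝ) → ℝ}
    (hf : ContDiff ℝ 2 f) (hh : ContDiff ℝ 1 h) (hc : HasCompactSupport h) :
    ∫ x, poissonBracket m f h x = 0 := by
  have hint : ∀ v w, Integrable fun x ↦ fderiv ℝ f x v * fderiv ℝ h x w := fun v w ↦
    (((hf.continuous_fderiv two_ne_zero).clm_apply continuous_const).mul
      ((hh.continuous_fderiv one_ne_zero).clm_apply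
        continuous_const)).integrable_of_hasCompactSupport
        (hc.fderiv_apply (𝕜 := ℝ) w).mul_left
  have hint' : ∀ v w, Integrable fun x ↦
      fderiv ℝ f x v * fderiv ℝ h x w - fderiv ℝ f x w * fderiv ℝ h x v := fun v w ↦
    (hint v w).sub (hint w v)
  unfold poissonBracket
  rw [integral_finsetSum _ fun i _ ↦ hint' _ _]
  refine Finset.sum_eq_zero fun i _ ↦ ?_
  rw [integral_sub (hint _ _) (hint _ _), integral_fderiv_mul_fderiv_comm hf hh hc, sub_self]

/-- Every partial derivative is, on a given compact set, the bracket with a test function. -/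
theorem exists_poissonBracket_eq_fderiv {m : ℕ} (k : Fin (2 * m)) {K : Set (Fin (2 * m) → ℝ)}
    (hK : IsCompact K) :
    ∃ f : (Fin (2 * m) → ℝ) → ℝ, ContDiff ℝ (⊤ : ℕ∞) f ∧ HasCompactSupport f ∧
      ∀ g, ∀ x ∈ K, poissonBracket m f g x = fderiv ℝ g x (Pi.single k 1) := by
  rcases lt_or_ge k.1 m with hk | hk
  · obtain ⟨f, hf, hfc, hfd⟩ := exists_contDiff_fderiv_eq
      (-ContinuousLinearMap.proj (R := ℝ) (φ := fun _ : Fin (2 * m) ↦ ℝ) ⟨m + k.1, by omega⟩) hK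
    refine ⟨f, hf, hfc, fun g x hx ↦ ?_⟩
    rw [poissonBracket, Finset.sum_eq_single ⟨k.1, hk⟩]
    · rw [hfd x hx]
      simp [Pi.single_apply, Fin.ext_iff]
      intros; omega
    · intro i _ hi
      have hi' : ¬ k.1 = i.1 := fun h ↦ hi (Fin.ext h.symm)
      have hi'' : ¬ m + k.1 = i.1 := by omega
      rw [hfd x hx]
      simp [Fin.ext_iff, hi', hi'']
    · simp
  · obtain ⟨f, hf, hfc, hfd⟩ := exists_contDiff_fderiv_eq
      (ContinuousLinearMap.proj (R := ℝ) (φ := fun _ : Fin (2 * m) ↦ ℝ) ⟨k.1 - m, by omega⟩) hK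
    refine ⟨f, hf, hfc, fun g x hx ↦ ?_⟩
    have hkm : k.1 - m < m := by omega
    have hk' : (⟨m + (k.1 - m), by omega⟩ : Fin (2 * m)) = k := Fin.ext (by simp; omega)
    rw [poissonBracket, Finset.sum_eq_single ⟨k.1 - m, hkm⟩]
    · rw [hfd x hx]
      simp [Pi.single_apply, Fin.ext_iff, hk']
      intros; omega
    · intro i _ hi
      have hi' : ¬ k.1 - m = i.1 := fun h ↦ hi (Fin.ext h.symm)
      have hi'' : ¬ k.1 - m = m + i.1 := by omega
      rw [hfd x hx]
      simp [Fin.ext_iff, hi', hi'']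
    · simp

/-- The KMS condition implies the integration by parts formula `∫ ∂ₖφ dμ = ∫ φ ∂ₖH dμ`. -/
theorem integral_fderiv_eq_of_kms {m : ℕ} {H : (Fin (2 * m) → ℝ) → ℝ} (hH : ContDiff ℝ 1 H)
    {μ : Measure (Fin (2 * m) → ℝ)} [IsFiniteMeasureOnCompacts μ]
    (hμ : ∀ f g : (Fin (2 * m) → ℝ) → ℝ, ContDiff ℝ (⊤ : ℕ∞) f → ContDiff ℝ (⊤ : ℕ∞) g →
      HasCompactSupport f → HasCompactSupport g →
      ∫ x, poissonBracket m f g x ∂μ = ∫ x, g x * poissonBracket m f H x ∂μ)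
    (k : Fin (2 * m)) {φ : (Fin (2 * m) → ℝ) → ℝ} (hφ : ContDiff ℝ 1 φ)
    (hc : HasCompactSupport φ) :
    ∫ x, fderiv ℝ φ x (Pi.single k 1) ∂μ = ∫ x, φ x * fderiv ℝ H x (Pi.single k 1) ∂μ := by
  refine integral_fderiv_eq_of_forall_contDiff
    ((hH.continuous_fderiv one_ne_zero).clm_apply continuous_const) (fun g hg hgc ↦ ?_) hφ hc
  obtain ⟨f, hf, hfc, hfk⟩ := exists_poissonBracket_eq_fderiv k hgc.isCompact
  convert hμ f g hf hg hfc hgc using 3 with x x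
  · by_cases hx : x ∈ tsupport g
    · rw [hfk g x hx]
    · rw [poissonBracket_of_notMem_tsupport hx, fderiv_of_notMem_tsupport ℝ hx]
      rfl
  · by_cases hx : x ∈ tsupport g
    · rw [hfk H x hx]
    · rw [image_eq_zero_of_notMem_tsupport hx, zero_mul, zero_mul]

theorem isAddLeftInvariant_of_map_single {n : ℕ} {ν : Measure (Fin n → ℝ)}
    (h : ∀ k (t : ℝ), ν.map (Pi.single k t + ·) = ν) : ν.IsAddLeftInvariant where
  map_add_left_eq_self v := by
    rw [← Finset.univ_sum_single v]
    refine Finset.sum_induction _ (fun v : Fin n → ℝ ↦ ν.map (v + ·) = ν) (fun a b ha hb ↦ ?_)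
      (by simp) fun k _ ↦ h k (v k)
    have : (a + b + ·) = (a + ·) ∘ (b + ·) := by ext; simp [add_assoc]
    rw [this, ← Measure.map_map (measurable_const_add a) (measurable_const_add b), hb, ha]

/-- A measure satisfying the integration by parts formula for `H` is proportional to
`e^{-H} dx`. -/
theorem exists_eq_smul_withDensity_exp_neg {n : ℕ} {H : (Fin n → ℝ) → ℝ} (hH : ContDiff ℝ 1 H)
    {μ : Measure (Fin n → ℝ)} [IsFiniteMeasure μ]
    (h : ∀ k, ∀ φ : (Fin n → ℝ) → ℝ, ContDiff ℝ 1 φ → HasCompactSupport φ →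
      ∫ x, fderiv ℝ φ x (Pi.single k 1) ∂μ = ∫ x, φ x * fderiv ℝ H x (Pi.single k 1) ∂μ) :
    ∃ c : ENNReal, μ = c • volume.withDensity fun x ↦ ENNReal.ofReal (Real.exp (-H x)) := by
  have hexp : Continuous fun x ↦ Real.exp (H x) := Real.continuous_exp.comp hH.continuous
  set ν := μ.withDensity fun x ↦ ENNReal.ofReal (Real.exp (H x))
  have : IsLocallyFiniteMeasure ν := IsLocallyFiniteMeasure.withDensity_ofReal hexp
  have hmeas : Measurable fun x ↦ ENNReal.ofReal (Real.exp (H x)) :=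
    hexp.measurable.ennreal_ofReal
  have hν : ∀ (k : Fin n) (t : ℝ), ν.map (Pi.single k t + ·) = ν := by
    refine fun k t ↦ map_add_left_eq_self_of_integral_fderiv_eq_zero fun ψ hψ hψc ↦ ?_
    have hsingle : (Pi.single k t : Fin n → ℝ) = t • Pi.single k 1 := by
      rw [← Pi.single_smul, smul_eq_mul, mul_one]
    simp_rw [hsingle, map_smul, smul_eq_mul]
    rw [integral_const_mul, mul_eq_zero]
    right
    rw [integral_withDensity_eq_integral_toReal_smul hmeas
      (.of_forall fun _ ↦ ENNReal.ofReal_lt_top)]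
    simp_rw [ENNReal.toReal_ofReal (Real.exp_nonneg _), smul_eq_mul]
    have key := h k (fun x ↦ ψ x * Real.exp (H x)) (hψ.mul hH.exp) hψc.mul_right
    set e : Fin n → ℝ := Pi.single k 1
    have hd : ∀ x, fderiv ℝ (fun y ↦ ψ y * Real.exp (H y)) x e =
        Real.exp (H x) * fderiv ℝ ψ x e + ψ x * Real.exp (H x) * fderiv ℝ H x e := by
      intro x
      rw [HasFDerivAt.fderiv (f := fun y ↦ ψ y * Real.exp (H y))
        ((hψ.differentiable one_ne_zero x).hasFDerivAt.mul
          (hH.differentiable one_ne_zero x).hasFDerivAt.exp)]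
      simp
      ring
    have hψe : Continuous fun x ↦ fderiv ℝ ψ x e :=
      (hψ.continuous_fderiv one_ne_zero).clm_apply continuous_const
    have hHe : Continuous fun x ↦ fderiv ℝ H x e :=
      (hH.continuous_fderiv one_ne_zero).clm_apply continuous_const
    have hint₁ : Integrable (fun x ↦ Real.exp (H x) * fderiv ℝ ψ x e) μ :=
      (hexp.mul hψe).integrable_of_hasCompactSupport (hψc.fderiv_apply (𝕜 := ℝ) e).mul_left
    have hint₂ : Integrable (fun x ↦ ψ x * Real.exp (H x) * fderiv ℝ H x e) μ :=
      ((hψ.continuous.mul hexp).mul hHe).integrable_of_hasCompactSupport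
        hψc.mul_right.mul_right
    simp_rw [hd] at key
    rwa [integral_add hint₁ hint₂, add_eq_right] at key
  have := isAddLeftInvariant_of_map_single hν
  obtain ⟨c, hc⟩ : ∃ c : NNReal, ν = c • volume :=
    ⟨_, Measure.isAddLeftInvariant_eq_smul ν volume⟩
  refine ⟨c, ?_⟩
  have hμ := withDensity_inv_same (μ := μ) hmeas (.of_forall fun x ↦ by simp [Real.exp_pos])
    (.of_forall fun x ↦ ENNReal.ofReal_ne_top)
  change ν.withDensity _ = μ at hμ
  rw [← hμ, hc]
  simp_rw [← ENNReal.ofReal_inv_of_pos (Real.exp_pos _), ← Real.exp_neg]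
  exact withDensity_smul_measure _ _

/-- The measure `e^{-H} dx` satisfies the KMS condition. -/
theorem kms_withDensity_exp_neg {m : ℕ} {H : (Fin (2 * m) → ℝ) → ℝ} (hH : ContDiff ℝ 1 H)
    {f g : (Fin (2 * m) → ℝ) → ℝ} (hf : ContDiff ℝ 2 f) (hg : ContDiff ℝ 1 g)
    (hgc : HasCompactSupport g) :
    ∫ x, poissonBracket m f g x ∂volume.withDensity (fun x ↦ ENNReal.ofReal (Real.exp (-H x))) =
      ∫ x, g x * poissonBracket m f H x
        ∂volume.withDensity (fun x ↦ ENNReal.ofReal (Real.exp (-H x))) := by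
  have hexp : Continuous fun x ↦ Real.exp (-H x) := Real.continuous_exp.comp hH.continuous.neg
  have hf1 : ContDiff ℝ 1 f := hf.of_le one_le_two
  simp_rw [integral_withDensity_eq_integral_toReal_smul hexp.measurable.ennreal_ofReal
    (.of_forall fun _ ↦ ENNReal.ofReal_lt_top), ENNReal.toReal_ofReal (Real.exp_nonneg _),
    smul_eq_mul]
  have hfg : HasCompactSupport (poissonBracket m f g) :=
    .intro hgc.isCompact fun x hx ↦ poissonBracket_of_notMem_tsupport hx
  have hint₁ : Integrable fun x ↦ Real.exp (-H x) * poissonBracket m f g x :=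
    (hexp.mul (continuous_poissonBracket hf1 hg)).integrable_of_hasCompactSupport hfg.mul_left
  have hint₂ : Integrable fun x ↦ Real.exp (-H x) * (g x * poissonBracket m f H x) :=
    (hexp.mul (hg.continuous.mul
      (continuous_poissonBracket hf1 hH))).integrable_of_hasCompactSupport hgc.mul_right.mul_left
  rw [← sub_eq_zero, ← integral_sub hint₁ hint₂,
    ← integral_poissonBracket_eq_zero hf (hg.mul hH.neg.exp) hgc.mul_right]
  exact integral_congr_ae (.of_forall fun x ↦ (poissonBracket_mul_exp_neg
    (hg.differentiable one_ne_zero x) (hH.differentiable one_ne_zero x)).symm)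

/-- Let `m ≥ 1` and `H : ℝ^{2m} → ℝ` be `C¹` with `e^{-H}` Lebesgue integrable. A Borel
probability measure `μ` on `ℝ^{2m}` satisfies the classical KMS condition
`∫ {f,g} dμ = ∫ g {f,H} dμ` for all smooth compactly supported `f, g` if and only if
`μ` is the Gibbs measure `dμ = Z⁻¹ e^{-H} dx`, `Z := ∫ e^{-H} dx`. In particular, the
classical KMS state is unique and coincides with the Gibbs state. -/
theorem stmt15 (m : ℕ) (hm : 1 ≤ m) (H : (Fin (2 * m) → ℝ) → ℝ) (hH : ContDiff ℝ 1 H)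
    (hint : Integrable (fun x : Fin (2 * m) → ℝ => Real.exp (-H x)))
    (μ : Measure (Fin (2 * m) → ℝ)) [IsProbabilityMeasure μ] :
    (∀ f g : (Fin (2 * m) → ℝ) → ℝ, ContDiff ℝ (⊤ : ℕ∞) f → ContDiff ℝ (⊤ : ℕ∞) g →
        HasCompactSupport f → HasCompactSupport g →
        ∫ x, poissonBracket m f g x ∂μ = ∫ x, g x * poissonBracket m f H x ∂μ) ↔
      μ = (ENNReal.ofReal (∫ x : Fin (2 * m) → ℝ, Real.exp (-H x)))⁻¹ •
        volume.withDensity fun x => ENNReal.ofReal (Real.exp (-H x)) := by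
  constructor
  · intro h
    obtain ⟨c, hc⟩ := exists_eq_smul_withDensity_exp_neg hH
      fun k φ hφ hφc ↦ integral_fderiv_eq_of_kms hH h k hφ hφc
    have hmass : c * ENNReal.ofReal (∫ x : Fin (2 * m) → ℝ, Real.exp (-H x)) = 1 := by
      rw [ofReal_integral_eq_lintegral_ofReal hint (.of_forall fun x ↦ Real.exp_nonneg _),
        ← setLIntegral_univ, ← withDensity_apply _ .univ, ← smul_eq_mul, ← Measure.smul_apply,
        ← hc, measure_univ]
    rw [← ENNReal.eq_inv_of_mul_eq_one_left hmass]
    exact hc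
  · intro h f g hf hg _ hgc
    rw [h, integral_smul_measure, integral_smul_measure, kms_withDensity_exp_neg hH
      (contDiff_infty.mp hf 2) (contDiff_infty.mp hg 1) hgc]
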